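/- arXiv:2206.13359 — 6 statements merged into one kernel-verified Lean document; each statement's English description precedes it below -/
import Mathlib

section
/- Let R be a commutative noetherian ring, let n ≥ 1, and let A be a commutative R-algebra equipped with a ℤ/nℤ-grading A = ⨁_{ī ∈ ℤ/nℤ} A_ī such that the structure map R → A lands in A_0̄. If A is an R-algebra of finite type, then the degree-zero subalgebra A_0̄ is an R-algebra of finite type and A is finitely generated as a module over A_0̄. -/
/-- A homogeneous element of a commutative `ZMod n`-graded algebra, `n ≠ 0`, is integral over the
degree-zero subalgebra, since its `n`-th power has degree zero. -/
theorem isIntegral_gradeZero_of_mem {R A : Type*} [CommRing R] [CommRing A] [Algebra R A]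
    {n : ℕ} (hn : n ≠ 0) (𝒜 : ZMod n → Submodule R A) [SetLike.GradedMonoid 𝒜]
    {i : ZMod n} {a : A} (ha : a ∈ 𝒜 i) :
    IsIntegral (SetLike.GradeZero.subalgebra 𝒜) a := by
  have h : a ^ n ∈ 𝒜 0 := by
    simpa using SetLike.pow_mem_graded n ha
  exact .of_pow (Nat.pos_of_ne_zero hn)
    (isIntegral_algebraMap (A := A) (x := (⟨a ^ n, h⟩ : SetLike.GradeZero.subalgebra 𝒜)))

/-- A commutative `ZMod n`-graded algebra, `n ≠ 0`, is integral over its degree-zero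
subalgebra. -/
theorem algebra_isIntegral_gradeZero {R A : Type*} [CommRing R] [CommRing A] [Algebra R A]
    {n : ℕ} (hn : n ≠ 0) (𝒜 : ZMod n → Submodule R A) [GradedAlgebra 𝒜] :
    Algebra.IsIntegral (SetLike.GradeZero.subalgebra 𝒜) A where
  isIntegral a := by
    classical
    rw [← DirectSum.sum_support_decompose 𝒜 a]
    exact IsIntegral.sum _ fun i _ => isIntegral_gradeZero_of_mem hn 𝒜 (SetLike.coe_mem _)

/-- Let `R` be a commutative noetherian ring, `n ≥ 1`, and `A` a commutative
`R`-algebra with a `ℤ/nℤ`-grading `A = ⨁ A_ī` such that the structure map `R → A` lands in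
`A_0̄` (this holds for the notion of graded algebra used here).  If `A` is an `R`-algebra of
finite type, then the degree-zero subalgebra `A_0̄` is an `R`-algebra of finite type and `A` is
finitely generated as a module over `A_0̄`. -/
theorem stmt3 (R : Type*) [CommRing R] [IsNoetherianRing R]
    (A : Type*) [CommRing A] [Algebra R A]
    (n : ℕ) (hn : 1 ≤ n) (𝒜 : ZMod n → Submodule R A) [GradedAlgebra 𝒜]
    (hmap : ∀ r : R, algebraMap R A r ∈ 𝒜 0)
    (hft : Algebra.FiniteType R A) :
    ∃ A₀ : Subalgebra R A, (A₀ : Set A) = (𝒜 0 : Set A) ∧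
      Algebra.FiniteType R A₀ ∧ Module.Finite A₀ A := by
  have : Algebra.IsIntegral (SetLike.GradeZero.subalgebra 𝒜) A :=
    algebra_isIntegral_gradeZero (Nat.one_le_iff_ne_zero.mp hn) 𝒜
  have : Algebra.FiniteType (SetLike.GradeZero.subalgebra 𝒜) A :=
    .of_restrictScalars_finiteType R _ A
  have hfin : Module.Finite (SetLike.GradeZero.subalgebra 𝒜) A := Algebra.IsIntegral.finite
  exact ⟨SetLike.GradeZero.subalgebra 𝒜, rfl,
    ⟨fg_of_fg_of_fg R _ A hft.1 hfin.1 Subtype.val_injective⟩, hfin⟩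
end

section
/- Let R be a commutative noetherian ring, let Λ be an associative unital R-algebra that is finitely generated as an R-module, and let R → S be a flat homomorphism of commutative rings. Then the canonical map Z(Λ) ⊗_R S → Λ ⊗_R S is injective and its image is exactly the center of Λ ⊗_R S. In particular Z(Λ ⊗_R S) ≅ Z(Λ) ⊗_R S as S-algebras. -/
open scoped TensorProduct

attribute [local instance] Algebra.TensorProduct.rightAlgebra

/-- For `Λ` a module-finite algebra and `S` a flat module,
an element of `Λ ⊗ S` killed by `[g, -] ⊗ S` for all `g` comes from `Z(Λ) ⊗ S`. -/
theorem mem_range_rTensor_center_of_flat {R Λ S : Type*} [CommRing R] [Ring Λ] [Algebra R Λ]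
    [Module.Finite R Λ] [AddCommGroup S] [Module R S] [Module.Flat R S] (z : Λ ⊗[R] S)
    (hz : ∀ g : Λ, (LinearMap.mulLeft R g - LinearMap.mulRight R g).rTensor S z = 0) :
    z ∈ Set.range ((Subalgebra.center R Λ).val.toLinearMap.rTensor S) := by
  classical
  obtain ⟨s, hs⟩ := Module.Finite.fg_top (R := R) (M := Λ)
  let ad (g : Λ) : Λ →ₗ[R] Λ := LinearMap.mulLeft R g - LinearMap.mulRight R g
  let f : Λ →ₗ[R] (s → Λ) := ∑ g : s, LinearMap.single R (fun _ : s ↦ Λ) g ∘ₗ ad g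
  have hf (x : Λ) (g : s) : f x g = g * x - x * g := by
    simp [f, ad, Finset.sum_apply, Pi.single_apply]
  have hexact : Function.Exact (Subalgebra.center R Λ).val.toLinearMap f := by
    intro x
    constructor
    · intro hx
      refine ⟨⟨x, Subalgebra.mem_center_iff.2 fun b ↦ ?_⟩, rfl⟩
      have hb : b ∈ Submodule.span R (s : Set Λ) := hs ▸ Submodule.mem_top
      induction hb using Submodule.span_induction with
      | mem g hg => exact sub_eq_zero.1 ((hf x ⟨g, hg⟩).symm.trans (congrFun hx ⟨g, hg⟩))
      | zero => simp
      | add a b _ _ ha hb => rw [add_mul, mul_add, ha, hb]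
      | smul r a _ ha => rw [smul_mul_assoc, mul_smul_comm, ha]
    · rintro ⟨c, rfl⟩
      ext g
      rw [hf]
      exact sub_eq_zero.2 (Subalgebra.mem_center_iff.1 c.2 g)
  refine (Module.Flat.rTensor_exact S hexact z).1 ?_
  have hsum : f.rTensor S =
      ∑ g : s, (LinearMap.single R (fun _ : s ↦ Λ) g ∘ₗ ad g).rTensor S :=
    map_sum (LinearMap.rTensorHom S) _ _
  rw [hsum, LinearMap.sum_apply]
  refine Finset.sum_eq_zero fun g _ ↦ ?_
  rw [LinearMap.rTensor_comp_apply, hz, map_zero]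

/-- The image of `Z(Λ) ⊗ S` in `Λ ⊗ S` is the center, for `Λ` module-finite and `S` flat. -/
theorem range_map_center_val_eq_center {R Λ S : Type*} [CommRing R] [Ring Λ] [Algebra R Λ]
    [Module.Finite R Λ] [CommRing S] [Algebra R S] [Module.Flat R S] :
    Set.range (Algebra.TensorProduct.map (Subalgebra.center R Λ).val (AlgHom.id R S)) =
      Set.center (Λ ⊗[R] S) := by
  ext z
  rw [Semigroup.mem_center_iff]
  constructor
  · rintro ⟨y, rfl⟩ w
    induction y with
    | zero => simp
    | add a b ha hb => rw [map_add, mul_add, add_mul, ha, hb]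
    | tmul c t =>
      induction w with
      | zero => simp
      | add a b ha hb => rw [mul_add, add_mul, ha, hb]
      | tmul l u =>
        have hc : l * (c : Λ) = c * l := Subalgebra.mem_center_iff.1 c.2 l
        simp [hc, mul_comm]
  · intro hz
    refine mem_range_rTensor_center_of_flat z fun g ↦ ?_
    have hl (z : Λ ⊗[R] S) : (LinearMap.mulLeft R g - LinearMap.mulRight R g).rTensor S z =
        (g ⊗ₜ[R] (1 : S)) * z - z * (g ⊗ₜ[R] (1 : S)) := by
      induction z with
      | zero => simp
      | add a b ha hb => rw [map_add, ha, hb, mul_add, add_mul]; abel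
      | tmul l u => simp
    rw [hl, hz, sub_self]

/-- Let `R` be a commutative noetherian ring, `Λ` an associative unital
`R`-algebra that is finitely generated as an `R`-module, and `R → S` a flat homomorphism of
commutative rings.  Then the canonical map `Z(Λ) ⊗_R S → Λ ⊗_R S` is injective and its image is
exactly the center of `Λ ⊗_R S`.  In particular `Z(Λ ⊗_R S) ≅ Z(Λ) ⊗_R S` as `S`-algebras. -/
theorem stmt4 (R : Type*) [CommRing R] [IsNoetherianRing R]
    (Λ : Type*) [Ring Λ] [Algebra R Λ] [Module.Finite R Λ]
    (S : Type*) [CommRing S] [Algebra R S] [Module.Flat R S] :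
    Function.Injective
      (Algebra.TensorProduct.map (Subalgebra.center R Λ).val (AlgHom.id R S)) ∧
    Set.range (Algebra.TensorProduct.map (Subalgebra.center R Λ).val (AlgHom.id R S)) =
      Set.center (Λ ⊗[R] S) ∧
    Nonempty (((Subalgebra.center R Λ) ⊗[R] S) ≃ₐ[S] Subalgebra.center S (Λ ⊗[R] S)) := by
  have hinj : Function.Injective
      (Algebra.TensorProduct.map (Subalgebra.center R Λ).val (AlgHom.id R S)) :=
    Module.Flat.rTensor_preserves_injective_linearMap (M := S)
      (Subalgebra.center R Λ).val.toLinearMap Subtype.val_injective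
  have hrange := range_map_center_val_eq_center (R := R) (Λ := Λ) (S := S)
  refine ⟨hinj, hrange, ⟨?_⟩⟩
  let φ : ((Subalgebra.center R Λ) ⊗[R] S) →ₐ[S] Λ ⊗[R] S :=
    { (Algebra.TensorProduct.map (Subalgebra.center R Λ).val (AlgHom.id R S)).toRingHom with
      commutes' := fun t ↦ by
        simp [Algebra.TensorProduct.right_algebraMap_apply] }
  refine AlgEquiv.ofBijective
    (φ.codRestrict (Subalgebra.center S (Λ ⊗[R] S)) fun y ↦ hrange.subset ⟨y, rfl⟩)
    ⟨fun a b h ↦ hinj (congrArg Subtype.val h), fun c ↦ ?_⟩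
  obtain ⟨y, hy⟩ := hrange.superset c.2
  exact ⟨y, Subtype.ext hy⟩
end

section
/- Let k be a field of characteristic p > 0 and let S be the quotient of the free associative k-algebra k⟨x,y,z⟩ by the two-sided ideal generated by xy − yx − z², xz − zx, and yz − zy. Then the center of S is exactly the k-subalgebra of S generated by the images of x^p, y^p and z. -/
/-- The defining relations of `S = k⟨x,y,z⟩/(xy − yx − z², xz − zx, yz − zy)`:
generator `0` is `x`, generator `1` is `y`, generator `2` is `z`. -/
inductive SRel (k : Type*) [CommRing k] :
    FreeAlgebra k (Fin 3) → FreeAlgebra k (Fin 3) → Prop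
  | xy : SRel k (FreeAlgebra.ι k 0 * FreeAlgebra.ι k 1)
      (FreeAlgebra.ι k 1 * FreeAlgebra.ι k 0 + FreeAlgebra.ι k 2 * FreeAlgebra.ι k 2)
  | xz : SRel k (FreeAlgebra.ι k 0 * FreeAlgebra.ι k 2)
      (FreeAlgebra.ι k 2 * FreeAlgebra.ι k 0)
  | yz : SRel k (FreeAlgebra.ι k 1 * FreeAlgebra.ι k 2)
      (FreeAlgebra.ι k 2 * FreeAlgebra.ι k 1)

/-- The algebra `S = k⟨x,y,z⟩/(xy − yx − z², xz − zx, yz − zy)`. -/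
noncomputable abbrev SAlg (k : Type*) [CommRing k] := RingQuot (SRel k)

/-- The image of `x` in `S`. -/
noncomputable def Sx (k : Type*) [CommRing k] : SAlg k :=
  RingQuot.mkAlgHom k (SRel k) (FreeAlgebra.ι k 0)

/-- The image of `y` in `S`. -/
noncomputable def Sy (k : Type*) [CommRing k] : SAlg k :=
  RingQuot.mkAlgHom k (SRel k) (FreeAlgebra.ι k 1)

/-- The image of `z` in `S`. -/
noncomputable def Sz (k : Type*) [CommRing k] : SAlg k :=
  RingQuot.mkAlgHom k (SRel k) (FreeAlgebra.ι k 2)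

open MvPolynomial in
/-- The linear map `k[X, Y, Z] → S` sending `X ^ i * Y ^ j * Z ^ l` to `y ^ j * x ^ i * z ^ l`. -/
noncomputable def normalOrder (k : Type*) [CommRing k] : MvPolynomial (Fin 3) k →ₗ[k] SAlg k :=
  (basisMonomials (Fin 3) k).constr k fun d => Sy k ^ d 1 * Sx k ^ d 0 * Sz k ^ d 2

theorem pow_mul_eq_of_mul_eq_add {A : Type*} [Ring A] {a b c : A} (h : a * b = b * a + c)
    (hc : Commute a c) (n : ℕ) : a ^ n * b = b * a ^ n + n * (a ^ (n - 1) * c) := by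
  induction n with
  | zero => simp
  | succ n ih =>
    have hn : a * ((n : A) * (a ^ (n - 1) * c)) = n * (a ^ n * c) := by
      rcases n with _ | n
      · simp
      · rw [← mul_assoc, ← Nat.cast_comm, mul_assoc, ← mul_assoc a, Nat.add_sub_cancel, ← pow_succ']
    have hca : c * a ^ n = a ^ n * c := (hc.pow_left n).symm.eq
    calc a ^ (n + 1) * b = a * (a ^ n * b) := by rw [pow_succ', mul_assoc]
      _ = a * b * a ^ n + a * ((n : A) * (a ^ (n - 1) * c)) := by rw [ih, mul_add, mul_assoc a b]
      _ = _ := by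
        rw [hn, h, add_mul, hca, pow_succ' a n, Nat.add_sub_cancel]
        push_cast
        noncomm_ring

theorem mul_pow_eq_of_mul_eq_add {A : Type*} [Ring A] {a b c : A} (h : a * b = b * a + c)
    (hc : Commute b c) (n : ℕ) : a * b ^ n = b ^ n * a + n * (b ^ (n - 1) * c) := by
  have h' : b * a = a * b + -c := by rw [h]; abel
  rw [pow_mul_eq_of_mul_eq_add h' hc.neg_right n]
  noncomm_ring

section

variable (k : Type*) [CommRing k]

theorem Sx_mul_Sy : Sx k * Sy k = Sy k * Sx k + Sz k ^ 2 := by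
  simpa [Sx, Sy, Sz, pow_two] using RingQuot.mkAlgHom_rel k (SRel.xy (k := k))

theorem commute_Sx_Sz : Commute (Sx k) (Sz k) := by
  simpa [Sx, Sz, commute_iff_eq] using RingQuot.mkAlgHom_rel k (SRel.xz (k := k))

theorem commute_Sy_Sz : Commute (Sy k) (Sz k) := by
  simpa [Sy, Sz, commute_iff_eq] using RingQuot.mkAlgHom_rel k (SRel.yz (k := k))

theorem SAlg_adjoin_eq_top : Algebra.adjoin k {Sx k, Sy k, Sz k} = ⊤ := by
  have h := congrArg (Subalgebra.map (RingQuot.mkAlgHom k (SRel k)))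
    (FreeAlgebra.adjoin_range_ι k (Fin 3))
  rw [Algebra.map_top, (AlgHom.range_eq_top _).2 (RingQuot.mkAlgHom_surjective k _),
    AlgHom.map_adjoin] at h
  rw [← h]
  congr 1
  ext s
  simp [Fin.exists_fin_succ, Sx, Sy, Sz, eq_comm]

variable {k}

theorem mem_center_SAlg {s : SAlg k} (hx : Commute (Sx k) s) (hy : Commute (Sy k) s)
    (hz : Commute (Sz k) s) : s ∈ Subalgebra.center k (SAlg k) := by
  have h : Algebra.adjoin k {Sx k, Sy k, Sz k} ≤ Subalgebra.centralizer k {s} := by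
    refine Algebra.adjoin_le ?_
    rintro _ (rfl | rfl | rfl) <;> rintro _ rfl
    exacts [hx.symm, hy.symm, hz.symm]
  rw [SAlg_adjoin_eq_top] at h
  rw [Subalgebra.mem_center_iff]
  intro t
  exact (Subalgebra.mem_centralizer_iff k |>.1 (h (Algebra.mem_top (x := t))) s rfl).symm

open MvPolynomial

theorem normalOrder_monomial (d : Fin 3 →₀ ℕ) (a : k) :
    normalOrder k (monomial d a) = a • (Sy k ^ d 1 * Sx k ^ d 0 * Sz k ^ d 2) := by
  have h : monomial d a = a • basisMonomials (Fin 3) k d := by simp [smul_monomial]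
  rw [h, map_smul, normalOrder, Module.Basis.constr_basis]

theorem normalOrder_mul_Sx (f : MvPolynomial (Fin 3) k) :
    normalOrder k f * Sx k = normalOrder k (X 0 * f) := by
  induction f using MvPolynomial.induction_on' with
  | monomial d a =>
    rw [X, monomial_mul]
    simp only [normalOrder_monomial, smul_mul_assoc, one_mul]
    congr 1
    simp [mul_assoc, ((commute_Sx_Sz k).pow_right (d 2)).symm.eq, pow_add,
      (Commute.self_pow (Sx k) (d 0)).left_comm]
  | add f g hf hg => simp [mul_add, add_mul, hf, hg]

theorem Sy_mul_normalOrder (f : MvPolynomial (Fin 3) k) :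
    Sy k * normalOrder k f = normalOrder k (X 1 * f) := by
  induction f using MvPolynomial.induction_on' with
  | monomial d a =>
    rw [X, monomial_mul]
    simp [normalOrder_monomial, mul_assoc, pow_add]
  | add f g hf hg => simp [mul_add, hf, hg]

theorem Sz_mul_normalOrder (f : MvPolynomial (Fin 3) k) :
    Sz k * normalOrder k f = normalOrder k (X 2 * f) := by
  induction f using MvPolynomial.induction_on' with
  | monomial d a =>
    rw [X, monomial_mul]
    simp only [normalOrder_monomial, mul_smul_comm, one_mul]
    congr 1
    have h : Commute (Sz k) (Sy k ^ d 1 * Sx k ^ d 0) :=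
      ((commute_Sy_Sz k).symm.pow_right _).mul_right ((commute_Sx_Sz k).symm.pow_right _)
    simp [← mul_assoc, h.eq, pow_add]
  | add f g hf hg => simp [mul_add, hf, hg]

theorem Sx_mul_normalOrder (f : MvPolynomial (Fin 3) k) :
    Sx k * normalOrder k f = normalOrder k (X 0 * f + X 2 ^ 2 * pderiv 1 f) := by
  rw [map_add, ← normalOrder_mul_Sx, pow_two, mul_assoc, ← Sz_mul_normalOrder,
    ← Sz_mul_normalOrder]
  induction f using MvPolynomial.induction_on' with
  | monomial d a =>
    simp only [pderiv_monomial, normalOrder_monomial, smul_mul_assoc, mul_smul_comm]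
    rw [mul_comm a, ← smul_smul, smul_comm, ← smul_add, Nat.cast_smul_eq_nsmul]
    congr 1
    have h := mul_pow_eq_of_mul_eq_add (Sx_mul_Sy k) ((commute_Sy_Sz k).pow_right 2) (d 1)
    have hz : Commute (Sz k ^ 2) (Sy k ^ (d 1 - 1)) := (commute_Sy_Sz k).symm.pow_pow _ _
    have hx : Commute (Sx k) (Sx k ^ d 0 * Sz k ^ d 2) :=
      (Commute.self_pow _ _).mul_right ((commute_Sx_Sz k).pow_right _)
    have hd : Sz k * (Sz k * (Sy k ^ (d 1 - 1) * Sx k ^ d 0 * Sz k ^ d 2)) =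
        Sy k ^ (d 1 - 1) * Sz k ^ 2 * (Sx k ^ d 0 * Sz k ^ d 2) := by
      rw [← mul_assoc, ← pow_two, mul_assoc (Sy k ^ (d 1 - 1)), ← mul_assoc, hz.eq]
    simp only [Finsupp.coe_tsub, Pi.sub_apply, Finsupp.single_apply, Fin.reduceEq, if_true,
      if_false, tsub_zero, one_ne_zero]
    rw [hd, mul_assoc (Sy k ^ d 1), ← mul_assoc, h, add_mul, mul_assoc _ (Sx k), hx.eq,
      nsmul_eq_mul, mul_assoc (d 1 : SAlg k), mul_assoc (Sy k ^ d 1)]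
  | add f g hf hg =>
    simp only [mul_add, add_mul, map_add, hf, hg]
    abel

theorem normalOrder_mul_Sy (f : MvPolynomial (Fin 3) k) :
    normalOrder k f * Sy k = normalOrder k (X 1 * f + X 2 ^ 2 * pderiv 0 f) := by
  rw [map_add, ← Sy_mul_normalOrder, pow_two, mul_assoc, ← Sz_mul_normalOrder,
    ← Sz_mul_normalOrder]
  induction f using MvPolynomial.induction_on' with
  | monomial d a =>
    simp only [pderiv_monomial, normalOrder_monomial, smul_mul_assoc, mul_smul_comm]
    rw [mul_comm a, ← smul_smul, smul_comm, ← smul_add, Nat.cast_smul_eq_nsmul]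
    congr 1
    have h := pow_mul_eq_of_mul_eq_add (Sx_mul_Sy k) ((commute_Sx_Sz k).pow_right 2) (d 0)
    have hz : Commute (Sz k ^ 2) (Sy k ^ d 1 * Sx k ^ (d 0 - 1)) :=
      ((commute_Sy_Sz k).symm.pow_pow _ _).mul_right ((commute_Sx_Sz k).symm.pow_pow _ _)
    have hy : Commute (Sz k ^ d 2) (Sy k) := (commute_Sy_Sz k).symm.pow_left _
    have hd : Sz k * (Sz k * (Sy k ^ d 1 * Sx k ^ (d 0 - 1) * Sz k ^ d 2)) =
        Sy k ^ d 1 * (Sx k ^ (d 0 - 1) * Sz k ^ 2) * Sz k ^ d 2 := by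
      rw [← mul_assoc, ← pow_two, ← mul_assoc, hz.eq, mul_assoc (Sy k ^ d 1)]
    simp only [Finsupp.coe_tsub, Pi.sub_apply, Finsupp.single_apply, Fin.reduceEq, if_true,
      if_false, tsub_zero, zero_ne_one]
    rw [hd, mul_assoc _ _ (Sy k), hy.eq, ← mul_assoc, mul_assoc (Sy k ^ d 1), h, mul_add, add_mul,
      ← mul_assoc _ (Sy k), ← (Commute.self_pow (Sy k) _).eq, ← nsmul_eq_mul, mul_smul_comm,
      smul_mul_assoc]
    simp only [mul_assoc]
  | add f g hf hg =>
    simp only [mul_add, add_mul, map_add, hf, hg]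
    abel

variable (k) in
/-- The action of `S` on `k[X, Y, Z]` in which `y` and `z` multiply by `Y` and `Z`, and `x` acts as
`X + Z ^ 2 * ∂ / ∂Y`. -/
noncomputable def polyRep : SAlg k →ₐ[k] Module.End k (MvPolynomial (Fin 3) k) :=
  RingQuot.liftAlgHom k ⟨FreeAlgebra.lift k
    ![LinearMap.mulLeft k (X 0) + LinearMap.mulLeft k (X 2 ^ 2) * (pderiv 1).toLinearMap,
      LinearMap.mulLeft k (X 1), LinearMap.mulLeft k (X 2)], by
    rintro _ _ (_ | _ | _) <;> refine LinearMap.ext fun f => ?_ <;> simp <;> ring⟩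

theorem polyRep_Sx (f : MvPolynomial (Fin 3) k) :
    polyRep k (Sx k) f = X 0 * f + X 2 ^ 2 * pderiv 1 f := by
  simp [polyRep, Sx]

theorem polyRep_Sy (f : MvPolynomial (Fin 3) k) : polyRep k (Sy k) f = X 1 * f := by
  simp [polyRep, Sy]

theorem polyRep_Sz (f : MvPolynomial (Fin 3) k) : polyRep k (Sz k) f = X 2 * f := by
  simp [polyRep, Sz]

theorem normalOrder_polyRep (s : SAlg k) (f : MvPolynomial (Fin 3) k) :
    normalOrder k (polyRep k s f) = s * normalOrder k f := by
  have hs : s ∈ Algebra.adjoin k {Sx k, Sy k, Sz k} := by simp [SAlg_adjoin_eq_top]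
  induction hs using Algebra.adjoin_induction generalizing f with
  | mem s hs =>
    obtain rfl | rfl | rfl := hs
    · rw [polyRep_Sx, Sx_mul_normalOrder]
    · rw [polyRep_Sy, Sy_mul_normalOrder]
    · rw [polyRep_Sz, Sz_mul_normalOrder]
  | algebraMap r => simp [Algebra.algebraMap_eq_smul_one]
  | add s t _ _ hs ht => simp [hs, ht, add_mul]
  | mul s t _ _ hs ht => simp [hs, ht, mul_assoc]

theorem normalOrder_surjective : Function.Surjective (normalOrder k) := fun s =>
  ⟨polyRep k s 1, by
    rw [normalOrder_polyRep, ← C_1, ← monomial_zero', normalOrder_monomial]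
    simp⟩

theorem polyRep_normalOrder_one (f : MvPolynomial (Fin 3) k) :
    polyRep k (normalOrder k f) 1 = f := by
  induction f using MvPolynomial.induction_on' with
  | monomial d a =>
    have hz (n : ℕ) : polyRep k (Sz k ^ n) 1 = X 2 ^ n := by
      induction n with
      | zero => simp
      | succ n ih => rw [pow_succ', map_mul, Module.End.mul_apply, ih, polyRep_Sz, pow_succ']
    have hx (n m : ℕ) : polyRep k (Sx k ^ n) (X 2 ^ m) = X 0 ^ n * X 2 ^ m := by
      induction n with
      | zero => simp
      | succ n ih =>
        rw [pow_succ', map_mul, Module.End.mul_apply, ih, polyRep_Sx]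
        simp
        ring
    have hy (n : ℕ) (g : MvPolynomial (Fin 3) k) : polyRep k (Sy k ^ n) g = X 1 ^ n * g := by
      induction n with
      | zero => simp
      | succ n ih =>
        rw [pow_succ', map_mul, Module.End.mul_apply, ih, polyRep_Sy]
        ring
    rw [normalOrder_monomial, map_smul, LinearMap.smul_apply, map_mul, map_mul,
      Module.End.mul_apply, Module.End.mul_apply, hz, hx, hy, monomial_eq, smul_eq_C_mul,
      Finsupp.prod_fintype _ _ (by simp), Fin.prod_univ_three]
    ring
  | add f g hf hg => simp [hf, hg]

theorem normalOrder_injective : Function.Injective (normalOrder k) :=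
  Function.LeftInverse.injective (g := fun s => polyRep k s 1) polyRep_normalOrder_one

theorem eq_zero_of_X_sq_mul_eq_zero {f : MvPolynomial (Fin 3) k} (i : Fin 3)
    (h : X i ^ 2 * f = 0) : f = 0 := by
  have hX := (isRegular_X (R := k) (n := i)).pow 2
  exact hX.left (by simpa using h)

theorem dvd_of_pderiv_eq_zero {R σ : Type*} [CommRing R] [NoZeroDivisors R] (p : ℕ) [CharP R p]
    {f : MvPolynomial σ R} {i : σ} (h : pderiv i f = 0) {d : σ →₀ ℕ} (hd : d ∈ f.support) :
    p ∣ d i := by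
  by_cases h0 : d i = 0
  · simp [h0]
  have hle : Finsupp.single i 1 ≤ d := by simpa [Nat.one_le_iff_ne_zero] using h0
  have hc := coeff_pderiv (i := i) f (d - Finsupp.single i 1)
  rw [h, tsub_add_cancel_of_le hle, coeff_zero] at hc
  have := (mul_eq_zero.1 hc.symm).resolve_left (mem_support_iff.1 hd)
  rw [← CharP.cast_eq_zero_iff R p]
  rw [← this]
  have h1 : d i = (d i - 1) + 1 := by omega
  rw [h1]
  simp

theorem Sx_pow_char_mem_center (p : ℕ) [CharP k p] :
    Sx k ^ p ∈ Subalgebra.center k (SAlg k) := by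
  have hp : (p : SAlg k) = 0 := by
    rw [← map_natCast (algebraMap k (SAlg k)), CharP.cast_eq_zero, map_zero]
  refine mem_center_SAlg (Commute.self_pow _ _) ?_ ((commute_Sx_Sz k).symm.pow_right _)
  have := pow_mul_eq_of_mul_eq_add (Sx_mul_Sy k) ((commute_Sx_Sz k).pow_right 2) p
  rw [hp, zero_mul, add_zero] at this
  exact this.symm

theorem Sy_pow_char_mem_center (p : ℕ) [CharP k p] :
    Sy k ^ p ∈ Subalgebra.center k (SAlg k) := by
  have hp : (p : SAlg k) = 0 := by
    rw [← map_natCast (algebraMap k (SAlg k)), CharP.cast_eq_zero, map_zero]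
  refine mem_center_SAlg ?_ (Commute.self_pow _ _) ((commute_Sy_Sz k).symm.pow_right _)
  have := mul_pow_eq_of_mul_eq_add (Sx_mul_Sy k) ((commute_Sy_Sz k).pow_right 2) p
  rw [hp, zero_mul, add_zero] at this
  exact this

end

/-- Let `k` be a field of characteristic `p > 0` and let
`S = k⟨x,y,z⟩/(xy − yx − z², xz − zx, yz − zy)`.  Then the center of `S` is exactly the
`k`-subalgebra of `S` generated by the images of `x^p`, `y^p` and `z`. -/
theorem stmt5 (k : Type*) [Field k] (p : ℕ) (hp : 0 < p) [CharP k p] :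
    Subalgebra.center k (SAlg k) =
      Algebra.adjoin k {Sx k ^ p, Sy k ^ p, Sz k} := by
  apply le_antisymm
  · intro s hs
    obtain ⟨f, rfl⟩ := normalOrder_surjective s
    rw [Subalgebra.mem_center_iff] at hs
    have hx := hs (Sx k)
    have hy := hs (Sy k)
    rw [Sx_mul_normalOrder, normalOrder_mul_Sx] at hx
    rw [Sy_mul_normalOrder, normalOrder_mul_Sy] at hy
    have h1 := eq_zero_of_X_sq_mul_eq_zero 2 (add_eq_left.1 (normalOrder_injective hx))
    have h0 := eq_zero_of_X_sq_mul_eq_zero 2 (left_eq_add.1 (normalOrder_injective hy))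
    rw [f.as_sum, map_sum]
    refine sum_mem fun d hd => ?_
    obtain ⟨i, hi⟩ := dvd_of_pderiv_eq_zero p h0 hd
    obtain ⟨j, hj⟩ := dvd_of_pderiv_eq_zero p h1 hd
    rw [normalOrder_monomial, hi, hj, pow_mul, pow_mul]
    refine Subalgebra.smul_mem _ (mul_mem (mul_mem ?_ ?_) ?_) _ <;>
      exact pow_mem (Algebra.subset_adjoin (by simp)) _
  · refine Algebra.adjoin_le ?_
    rintro _ (rfl | rfl | rfl)
    · exact Sx_pow_char_mem_center p
    · exact Sy_pow_char_mem_center p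
    · exact mem_center_SAlg (commute_Sx_Sz k) (commute_Sy_Sz k) (Commute.refl _)
end

section
/- Let A be an associative unital ring and let c ∈ A be a normalizing element, i.e. cA = Ac. If cⁿ lies in the Jacobson radical J(A) for some n ≥ 1, then c itself lies in J(A). -/
theorem exists_pow_mul_eq_mul_pow {M : Type*} [Monoid M] {c : M}
    (hc : ∀ a, ∃ b, c * a = b * c) (k : ℕ) (a : M) : ∃ b, c ^ k * a = b * c ^ k := by
  induction k generalizing a with
  | zero => exact ⟨a, by simp⟩
  | succ k ih =>
    obtain ⟨a', ha'⟩ := hc a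
    obtain ⟨b, hb⟩ := ih a'
    exact ⟨b, by rw [pow_succ, mul_assoc, ha', ← mul_assoc, hb, mul_assoc]⟩

theorem exists_mul_pow_eq_mul_pow {M : Type*} [Monoid M] {c : M}
    (hc : ∀ a, ∃ b, c * a = b * c) (a : M) (k : ℕ) : ∃ b, (a * c) ^ k = b * c ^ k := by
  induction k with
  | zero => exact ⟨1, by simp⟩
  | succ k ih =>
    obtain ⟨b, hb⟩ := ih
    obtain ⟨a', ha'⟩ := exists_pow_mul_eq_mul_pow hc k a
    refine ⟨b * a', ?_⟩
    rw [pow_succ, hb, ← mul_assoc, mul_assoc b, ha', pow_succ]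
    simp only [mul_assoc]

theorem exists_mul_one_sub_eq_one_of_pow_mem_jacobson {A : Type*} [Ring A] {w : A} {n : ℕ}
    (hw : w ^ n ∈ Ideal.jacobson (⊥ : Ideal A)) : ∃ z, z * (1 - w) = 1 := by
  obtain ⟨z, hz⟩ := Ideal.mem_jacobson_iff.mp hw (-1)
  refine ⟨z * ∑ i ∈ Finset.range n, w ^ i, ?_⟩
  rw [mul_assoc, geom_sum_mul_neg, ← sub_eq_zero, ← Ideal.mem_bot.mp hz]
  noncomm_ring

/-- **Statement 8.** Let `A` be an associative unital ring and let `c ∈ A` be a normalizing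
element, i.e. `cA = Ac`.  If `cⁿ` lies in the Jacobson radical `J(A)` for some `n ≥ 1`, then
`c` itself lies in `J(A)`. -/
theorem stmt8 (A : Type*) [Ring A] (c : A)
    (hnorm : {x : A | ∃ a : A, x = c * a} = {x : A | ∃ a : A, x = a * c})
    (n : ℕ) (hn : 1 ≤ n) (h : c ^ n ∈ Ideal.jacobson (⊥ : Ideal A)) :
    c ∈ Ideal.jacobson (⊥ : Ideal A) := by
  have hc : ∀ a, ∃ b, c * a = b * c := fun a => hnorm.subset ⟨a, rfl⟩
  refine Ideal.mem_jacobson_iff.mpr fun y => ?_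
  obtain ⟨b, hb⟩ := exists_mul_pow_eq_mul_pow hc (-y) n
  obtain ⟨z, hz⟩ := exists_mul_one_sub_eq_one_of_pow_mem_jacobson
    (hb ▸ Ideal.mul_mem_left _ b h)
  refine ⟨z, Ideal.mem_bot.mpr ?_⟩
  rw [← hz]
  noncomm_ring
end

section
/- The 𝔽₃-algebras 𝔽₃[x,y,z]/(z³ − x² − y²) and 𝔽₃[x,y,z]/(z³ − xy) are not isomorphic as 𝔽₃-algebras. -/
open MvPolynomial

/-- The chain rule for a partial derivative of a polynomial expression in polynomials. -/
theorem pderiv_aeval_eq_sum {R σ τ : Type*} [CommRing R] [Fintype σ]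
    (a : σ → MvPolynomial τ R) (j : τ) (p : MvPolynomial σ R) :
    pderiv j (aeval a p) = ∑ k, aeval a (pderiv k p) * pderiv j (a k) := by
  classical
  induction p using MvPolynomial.induction_on with
  | C r => simp [algebraMap_eq]
  | add p q hp hq => simp only [map_add, hp, hq, add_mul, Finset.sum_add_distrib]
  | mul_X p i hp =>
    simp only [map_mul, aeval_X, Derivation.leibniz, hp, pderiv_X, smul_eq_mul, map_add,
      add_mul, Finset.sum_add_distrib, Finset.mul_sum]
    congr 1
    · rw [Finset.sum_eq_single i]
      · simp
      · intro k _ hk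
        simp [hk.symm]
      · simp
    · exact Finset.sum_congr rfl fun k _ => by ring

/-- If the variables are polynomial expressions in the `a k` modulo a polynomial that is singular at
the origin, then the Jacobian matrix of `a` at the origin is invertible. -/
theorem isUnit_jacobian_of_generate {R σ : Type*} [CommRing R] [Fintype σ] [DecidableEq σ]
    (f : MvPolynomial σ R) (hf : eval 0 f = 0) (hf' : ∀ i, eval 0 (pderiv i f) = 0)
    (a P : σ → MvPolynomial σ R) (h : ∀ i, f ∣ X i - aeval a (P i)) :
    IsUnit (Matrix.of fun k j => eval 0 (pderiv j (a k))) := by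
  rw [Matrix.isUnit_iff_isUnit_det]
  refine Matrix.isUnit_det_of_left_inverse
    (B := Matrix.of fun i k => eval 0 (aeval a (pderiv k (P i)))) ?_
  ext i j
  obtain ⟨g, hg⟩ := h i
  have key := congrArg (fun p => eval 0 (pderiv j p)) hg
  simp only [map_sub, Derivation.leibniz, smul_eq_mul, map_add, map_mul, hf, hf', mul_zero,
    zero_mul, add_zero, pderiv_aeval_eq_sum, map_sum, sub_eq_zero, pderiv_X] at key
  rw [Matrix.mul_apply, Matrix.one_apply]
  simp only [Matrix.of_apply, ← key, Pi.single_apply]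
  split_ifs <;> simp_all

/-- A product of two linear forms over `ZMod 3` in three variables is a multiple of the anisotropic
form `x ^ 2 + y ^ 2` only if one of the two linear forms vanishes. -/
theorem eq_zero_or_eq_zero_of_polar_eq (u v : Fin 3 → ZMod 3) (g : ZMod 3)
    (h : ∀ i j, u i * v j + u j * v i = if i = j ∧ i ≠ 2 then g else 0) : u = 0 ∨ v = 0 := by
  have plane : ∀ a b c d : ZMod 3, a * c + c * a = b * d + d * b → a * d + b * c = 0 →
      (a = 0 ∧ b = 0) ∨ (c = 0 ∧ d = 0) := by decide
  have double : ∀ a b : ZMod 3, a * b + a * b = 0 → a = 0 ∨ b = 0 := by decide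
  have h00 := h 0 0
  have h11 := h 1 1
  have h22 := h 2 2
  have h01 := h 0 1
  have h02 := h 0 2
  have h12 := h 1 2
  simp at h00 h11 h22 h01 h02 h12
  simp only [funext_iff, Fin.forall_fin_succ]
  rcases plane (u 0) (u 1) (v 0) (v 1) (by linear_combination h00 - h11) h01 with
    ⟨h0, h1⟩ | ⟨h0, h1⟩ <;>
  · have h2 := double (u 2) (v 2) h22
    simp only [h0, h1, zero_mul, mul_zero, zero_add, add_zero, mul_eq_zero] at h02 h12
    simp [h0, h1]
    tauto

/-- **Statement 11.** The `𝔽₃`-algebras `𝔽₃[x,y,z]/(z³ − x² − y²)` and `𝔽₃[x,y,z]/(z³ − xy)`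
are not isomorphic as `𝔽₃`-algebras.  (Here `x = X 0`, `y = X 1`, `z = X 2`.) -/
theorem stmt11 :
    IsEmpty ((MvPolynomial (Fin 3) (ZMod 3) ⧸
        Ideal.span {(X 2 : MvPolynomial (Fin 3) (ZMod 3)) ^ 3 - X 0 ^ 2 - X 1 ^ 2}) ≃ₐ[ZMod 3]
      (MvPolynomial (Fin 3) (ZMod 3) ⧸
        Ideal.span {(X 2 : MvPolynomial (Fin 3) (ZMod 3)) ^ 3 - X 0 * X 1})) := by
  refine ⟨fun e => ?_⟩
  set f : MvPolynomial (Fin 3) (ZMod 3) := X 2 ^ 3 - X 0 ^ 2 - X 1 ^ 2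
  set q : MvPolynomial (Fin 3) (ZMod 3) := X 2 ^ 3 - X 0 * X 1
  have three : (3 : MvPolynomial (Fin 3) (ZMod 3)) = 0 := CharP.cast_eq_zero _ 3
  have two : constantCoeff (2 : MvPolynomial (Fin 3) (ZMod 3)) = 2 := map_ofNat _ 2
  have cube (p : MvPolynomial (Fin 3) (ZMod 3)) (i : Fin 3) : pderiv i (p ^ 3) = 0 := by
    rw [Derivation.leibniz_pow, nsmul_eq_mul]
    simp [three]
  have hf : eval 0 f = 0 := by simp [f]
  have hf1 (i : Fin 3) : eval 0 (pderiv i f) = 0 := by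
    simp only [f, map_sub, cube]
    simp [Derivation.leibniz_pow]
  have hf2 (i j : Fin 3) :
      eval 0 (pderiv i (pderiv j f)) = if i = j ∧ i ≠ 2 then 1 else 0 := by
    simp only [f, map_sub, cube]
    fin_cases i <;> fin_cases j <;>
      simp [Derivation.leibniz_pow, pderiv_X, two] <;> decide
  choose a ha using fun k : Fin 3 => Ideal.Quotient.mk_surjective
    (e.symm (Ideal.Quotient.mk (Ideal.span {q}) (X k)))
  choose P hP using fun k : Fin 3 => Ideal.Quotient.mk_surjective
    (e (Ideal.Quotient.mk (Ideal.span {f}) (X k)))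
  have comp (p : MvPolynomial (Fin 3) (ZMod 3)) :
      Ideal.Quotient.mk (Ideal.span {f}) (aeval a p) =
        e.symm (Ideal.Quotient.mk (Ideal.span {q}) p) := by
    have : (Ideal.Quotient.mkₐ (ZMod 3) (Ideal.span {f})).comp (aeval a) =
        (e.symm : _ →ₐ[ZMod 3] _).comp (Ideal.Quotient.mkₐ (ZMod 3) (Ideal.span {q})) := by
      ext k
      simpa using ha k
    exact DFunLike.congr_fun this p
  have hN := isUnit_jacobian_of_generate f hf hf1 a P fun i => by
    rw [← Ideal.mem_span_singleton, ← Ideal.Quotient.eq, comp, hP, e.symm_apply_apply]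
  obtain ⟨g, hg⟩ : f ∣ aeval a q := by
    rw [← Ideal.mem_span_singleton, ← Ideal.Quotient.eq_zero_iff_mem, comp,
      Ideal.Quotient.eq_zero_iff_mem.2 (Ideal.mem_span_singleton_self q), map_zero]
  simp only [q, map_sub, map_mul, map_pow, aeval_X] at hg
  set u : Fin 3 → ZMod 3 := fun j => eval 0 (pderiv j (a 0))
  set v : Fin 3 → ZMod 3 := fun j => eval 0 (pderiv j (a 1))
  have indep (s t : ZMod 3) (h : ∀ j, s * u j + t * v j = 0) : s = 0 ∧ t = 0 := by
    have h0 : Matrix.vecMul ![s, t, 0] (Matrix.of fun k j => eval 0 (pderiv j (a k))) =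
        Matrix.vecMul 0 (Matrix.of fun k j => eval 0 (pderiv j (a k))) := by
      ext j
      simpa [Matrix.vecMul, dotProduct, Fin.sum_univ_three, u, v] using h j
    have h1 := Matrix.vecMul_injective_of_isUnit hN h0
    exact ⟨congrFun h1 0, congrFun h1 1⟩
  have first (j : Fin 3) : -(a 0 * pderiv j (a 1) + a 1 * pderiv j (a 0)) =
      f * pderiv j g + g * pderiv j f := by
    simpa [cube, Derivation.leibniz] using congrArg (pderiv j) hg
  obtain ⟨hb0, ha0⟩ := indep (eval 0 (a 1)) (eval 0 (a 0)) fun j => by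
    have := congrArg (eval 0) (first j)
    simp only [map_neg, map_add, map_mul, hf, hf1] at this
    linear_combination -this
  have second (i j : Fin 3) : u i * v j + u j * v i =
      if i = j ∧ i ≠ 2 then -eval 0 g else 0 := by
    have := congrArg (fun p => eval 0 (pderiv i p)) (first j)
    simp only [map_neg, map_add, map_mul, Derivation.leibniz, smul_eq_mul, hf, hf1, hf2,
      ha0, hb0] at this
    split_ifs at this ⊢ <;> linear_combination -this
  rcases eq_zero_or_eq_zero_of_polar_eq u v _ second with h | h
  · exact one_ne_zero (indep 1 0 fun j => by simp [h]).1
  · exact one_ne_zero (indep 0 1 fun j => by simp [h]).2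
end

section
/- Let L be a field and equip the polynomial ring L[u,v] with the ℤ/3ℤ-grading determined by assigning u degree 1̄ and v degree 2̄ (a monomial u^a v^b has degree the residue of a + 2b modulo 3). Then the subalgebra of elements of degree 0̄ equals the L-subalgebra of L[u,v] generated by u³, v³ and uv. Moreover the L-algebra homomorphism L[X,Y,Z] → L[u,v] determined by X ↦ u³, Y ↦ v³, Z ↦ uv has kernel exactly the ideal generated by XY − Z³; consequently L[X,Y,Z]/(XY − Z³) is isomorphic as an L-algebra to the degree-0̄ subalgebra of L[u,v]. -/
open MvPolynomial

/-- The `ℤ/3ℤ`-degree of `u^a v^b` vanishes exactly when `a` and `b` agree modulo `3`. -/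
theorem weight_one_two_eq_zero_iff (d : Fin 2 →₀ ℕ) :
    Finsupp.weight (![1, 2] : Fin 2 → ZMod 3) d = 0 ↔ d 0 % 3 = d 1 % 3 := by
  have key : Finsupp.weight (![1, 2] : Fin 2 → ZMod 3) d = ((d 0 + 2 * d 1 : ℕ) : ZMod 3) := by
    rw [Finsupp.weight_apply, Finsupp.sum_fintype _ _ (by simp)]
    simp [mul_comm]
  rw [key, ZMod.natCast_eq_zero_iff]
  omega

section

variable (R : Type*) [CommRing R]

/-- The algebra homomorphism `R[X,Y,Z] → R[u,v]` with `X ↦ u³`, `Y ↦ v³`, `Z ↦ uv`. -/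
noncomputable abbrev cubicParam : MvPolynomial (Fin 3) R →ₐ[R] MvPolynomial (Fin 2) R :=
  aeval (![X 0 ^ 3, X 1 ^ 3, X 0 * X 1] : Fin 3 → MvPolynomial (Fin 2) R)

/-- The linear map `R[u,v] → R[X,Y,Z]` sending `u^a v^b` to `X^(a/3) Y^(b/3) Z^(a%3)`, a section of
`cubicParam` on the degree-zero part. -/
noncomputable def cubicSection : MvPolynomial (Fin 2) R →ₗ[R] MvPolynomial (Fin 3) R :=
  (basisMonomials (Fin 2) R).constr R
    fun d => X 0 ^ (d 0 / 3) * X 1 ^ (d 1 / 3) * X 2 ^ (d 0 % 3)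

theorem monomial_fin_two (d : Fin 2 →₀ ℕ) :
    monomial d (1 : R) = X 0 ^ d 0 * X 1 ^ d 1 := by
  rw [monomial_eq, Finsupp.prod_fintype _ _ (by simp)]
  simp

theorem cubicSection_X_pow_mul (a b : ℕ) :
    cubicSection R (X 0 ^ a * X 1 ^ b) = X 0 ^ (a / 3) * X 1 ^ (b / 3) * X 2 ^ (a % 3) := by
  have h := monomial_fin_two R (Finsupp.single 0 a + Finsupp.single 1 b)
  have h' := (basisMonomials (Fin 2) R).constr_basis R
    (fun d => (X 0 ^ (d 0 / 3) * X 1 ^ (d 1 / 3) * X 2 ^ (d 0 % 3) : MvPolynomial (Fin 3) R))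
    (Finsupp.single 0 a + Finsupp.single 1 b)
  simp only [coe_basisMonomials, h] at h'
  simpa [cubicSection] using h'

theorem mk_cubicSection_cubicParam (p : MvPolynomial (Fin 3) R) :
    Ideal.Quotient.mk (Ideal.span {(X 0 : MvPolynomial (Fin 3) R) * X 1 - X 2 ^ 3})
      (cubicSection R (cubicParam R p)) = Ideal.Quotient.mk _ p := by
  set I := Ideal.span {(X 0 : MvPolynomial (Fin 3) R) * X 1 - X 2 ^ 3}
  suffices h : (Ideal.Quotient.mkₐ R I).toLinearMap ∘ₗ cubicSection R ∘ₗ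
      (cubicParam R).toLinearMap = (Ideal.Quotient.mkₐ R I).toLinearMap from
    LinearMap.congr_fun h p
  refine (basisMonomials (Fin 3) R).ext fun d => ?_
  have hd : monomial d (1 : R) = X 0 ^ d 0 * X 1 ^ d 1 * X 2 ^ d 2 := by
    rw [monomial_eq, Finsupp.prod_fintype _ _ (by simp)]
    simp [Fin.prod_univ_three]
  have himg : cubicParam R (X 0 ^ d 0 * X 1 ^ d 1 * X 2 ^ d 2) =
      X 0 ^ (3 * d 0 + d 2) * X 1 ^ (3 * d 1 + d 2) := by
    simp only [map_mul, map_pow, aeval_X, Matrix.cons_val]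
    ring
  have hrel : Ideal.Quotient.mk I (X 0) * Ideal.Quotient.mk I (X 1) =
      Ideal.Quotient.mk I (X 2) ^ 3 := by
    rw [← map_mul, ← map_pow, Ideal.Quotient.eq]
    exact Ideal.subset_span rfl
  simp only [coe_basisMonomials, LinearMap.comp_apply, AlgHom.toLinearMap_apply,
    Ideal.Quotient.mkₐ_eq_mk, hd, himg, cubicSection_X_pow_mul, map_mul, map_pow]
  have h0 : (3 * d 0 + d 2) / 3 = d 0 + d 2 / 3 := by omega
  have h1 : (3 * d 1 + d 2) / 3 = d 1 + d 2 / 3 := by omega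
  have h2 : (3 * d 0 + d 2) % 3 = d 2 % 3 := by omega
  rw [h0, h1, h2]
  conv_rhs => rw [← Nat.div_add_mod (d 2) 3, pow_add, pow_mul, ← hrel]
  ring

theorem ker_cubicParam : RingHom.ker (cubicParam R) =
    Ideal.span {(X 0 : MvPolynomial (Fin 3) R) * X 1 - X 2 ^ 3} := by
  apply le_antisymm
  · intro p hp
    rw [← Ideal.Quotient.eq_zero_iff_mem, ← mk_cubicSection_cubicParam,
      (RingHom.mem_ker).1 hp, map_zero, map_zero]
  · rw [Ideal.span_singleton_le_iff_mem, RingHom.mem_ker]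
    simp only [map_sub, map_mul, map_pow, aeval_X, Matrix.cons_val]
    ring

theorem range_cubicParam : (cubicParam R).range =
    Algebra.adjoin R {(X 0 : MvPolynomial (Fin 2) R) ^ 3, X 1 ^ 3, X 0 * X 1} := by
  rw [← Algebra.adjoin_range_eq_range_aeval]
  congr 1
  ext x
  simp
  tauto

theorem mem_weightedHomogeneousSubmodule_one_two_iff (p : MvPolynomial (Fin 2) R) :
    p ∈ weightedHomogeneousSubmodule R (![1, 2] : Fin 2 → ZMod 3) 0 ↔
      p ∈ Algebra.adjoin R {(X 0 : MvPolynomial (Fin 2) R) ^ 3, X 1 ^ 3, X 0 * X 1} := by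
  rw [mem_weightedHomogeneousSubmodule]
  constructor
  · intro hp
    rw [← p.support_sum_monomial_coeff]
    refine Subalgebra.sum_mem _ fun d hd => ?_
    have hw := (weight_one_two_eq_zero_iff d).1 (hp (mem_support_iff.1 hd))
    have hm : monomial d (coeff d p) = coeff d p •
        ((X 0 ^ 3) ^ (d 0 / 3) * (X 1 ^ 3) ^ (d 1 / 3) * (X 0 * X 1) ^ (d 0 % 3)) := by
      have hu := congrArg (X (R := R) (0 : Fin 2) ^ ·) (Nat.div_add_mod (d 0) 3)
      have hv := congrArg (X (R := R) (1 : Fin 2) ^ ·) (Nat.div_add_mod (d 1) 3)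
      simp only [pow_add, pow_mul] at hu hv
      rw [← mul_one (coeff d p), ← smul_eq_mul, ← smul_monomial, monomial_fin_two, ← hu, ← hv,
        ← hw, smul_eq_mul, mul_one]
      congr 1
      ring
    rw [hm]
    refine Subalgebra.smul_mem _ (mul_mem (mul_mem ?_ ?_) ?_) _ <;>
      exact pow_mem (Algebra.subset_adjoin (by simp)) _
  · intro hp
    induction hp using Algebra.adjoin_induction with
    | mem x hx =>
      have hu := isWeightedHomogeneous_X R (![1, 2] : Fin 2 → ZMod 3) 0
      have hv := isWeightedHomogeneous_X R (![1, 2] : Fin 2 → ZMod 3) 1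
      obtain rfl | rfl | rfl := hx
      · exact hu.pow 3
      · exact hv.pow 3
      · exact hu.mul hv
    | algebraMap r => exact isWeightedHomogeneous_C _ r
    | add x y _ _ hx hy => exact hx.add hy
    | mul x y _ _ hx hy => simpa using hx.mul hy

end

/-- **Statement 12.** Let `L` be a field and equip `L[u,v]` with the `ℤ/3ℤ`-grading in which
`u` has degree `1̄` and `v` has degree `2̄` (a monomial `u^a v^b` is homogeneous of degree
`a + 2b` mod `3`).  Then the subalgebra of elements of degree `0̄` equals the `L`-subalgebra of
`L[u,v]` generated by `u³`, `v³` and `uv`.  Moreover the `L`-algebra homomorphism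
`L[X,Y,Z] → L[u,v]` determined by `X ↦ u³`, `Y ↦ v³`, `Z ↦ uv` has kernel exactly the ideal
generated by `XY − Z³`; consequently `L[X,Y,Z]/(XY − Z³)` is isomorphic as an `L`-algebra to
the degree-`0̄` subalgebra of `L[u,v]`.  (Here `u = X 0`, `v = X 1` in `L[u,v]`, and
`X = X 0`, `Y = X 1`, `Z = X 2` in `L[X,Y,Z]`.) -/
theorem stmt12 (L : Type*) [Field L] :
    ((weightedHomogeneousSubmodule L (![1, 2] : Fin 2 → ZMod 3) 0 :
        Submodule L (MvPolynomial (Fin 2) L)) : Set (MvPolynomial (Fin 2) L)) =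
      ((Algebra.adjoin L {(X 0 : MvPolynomial (Fin 2) L) ^ 3, X 1 ^ 3, X 0 * X 1} :
        Subalgebra L (MvPolynomial (Fin 2) L)) : Set (MvPolynomial (Fin 2) L)) ∧
    RingHom.ker (aeval
        (![X 0 ^ 3, X 1 ^ 3, X 0 * X 1] : Fin 3 → MvPolynomial (Fin 2) L) :
          MvPolynomial (Fin 3) L →ₐ[L] MvPolynomial (Fin 2) L) =
      Ideal.span {(X 0 : MvPolynomial (Fin 3) L) * X 1 - X 2 ^ 3} ∧
    Nonempty ((MvPolynomial (Fin 3) L ⧸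
        Ideal.span {(X 0 : MvPolynomial (Fin 3) L) * X 1 - X 2 ^ 3}) ≃ₐ[L]
      (Algebra.adjoin L {(X 0 : MvPolynomial (Fin 2) L) ^ 3, X 1 ^ 3, X 0 * X 1})) := by
  refine ⟨Set.ext (mem_weightedHomogeneousSubmodule_one_two_iff L), ker_cubicParam L, ⟨?_⟩⟩
  exact ((Ideal.quotientEquivAlgOfEq L (ker_cubicParam L).symm).trans
    (Ideal.quotientKerEquivRange (cubicParam L))).trans
    (Subalgebra.equivOfEq _ _ (range_cubicParam L))
end
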